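/- Suppose M u = λ₀ u for a vector u ∈ ℂ^{S̄⊕S}. Then the restriction u_S of u to the S coordinates satisfies R(λ₀) u_S = λ₀ u_S; that is, the restriction to S of any eigenvector of M for λ₀ is an eigenvector of the isospectral reduction R(λ₀) for the same eigenvalue λ₀. -/

import Mathlib

open Matrix

/-- The restriction to `S` of any eigenvector of `M` for `l0` is an eigenvector of the
isospectral reduction `R(l0) = D - C (A - l0 I)⁻¹ B` for the same eigenvalue `l0`. -/
theorem eigenvector_restriction_isospectral_reduction
    {Sbar S : Type*} [Fintype Sbar] [Fintype S] [Nonempty Sbar] [Nonempty S]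
    [DecidableEq Sbar] [DecidableEq S]
    (A : Matrix Sbar Sbar ℂ) (B : Matrix Sbar S ℂ) (C : Matrix S Sbar ℂ) (D : Matrix S S ℂ)
    (l0 : ℂ) (hA : IsUnit (A - l0 • (1 : Matrix Sbar Sbar ℂ)))
    (u : Sbar ⊕ S → ℂ)
    (hu : (fromBlocks A B C D).mulVec u = l0 • u) :
    (D - C * (A - l0 • (1 : Matrix Sbar Sbar ℂ))⁻¹ * B).mulVec (u ∘ Sum.inr)
      = l0 • (u ∘ Sum.inr) := by
  have h1 : A *ᵥ (u ∘ Sum.inl) + B *ᵥ (u ∘ Sum.inr) = l0 • (u ∘ Sum.inl) := by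
    have h := congrArg (fun v => v ∘ Sum.inl) hu
    rw [fromBlocks_mulVec] at h
    exact h
  have h2 : C *ᵥ (u ∘ Sum.inl) + D *ᵥ (u ∘ Sum.inr) = l0 • (u ∘ Sum.inr) := by
    have h := congrArg (fun v => v ∘ Sum.inr) hu
    rw [fromBlocks_mulVec] at h
    exact h
  have h3 : B *ᵥ (u ∘ Sum.inr)
      = -((A - l0 • (1 : Matrix Sbar Sbar ℂ)) *ᵥ (u ∘ Sum.inl)) := by
    rw [sub_mulVec, smul_mulVec, one_mulVec, ← h1]
    abel
  have hdet := (Matrix.isUnit_iff_isUnit_det _).mp hA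
  rw [sub_mulVec, ← mulVec_mulVec, h3, mulVec_neg, mulVec_mulVec, Matrix.mul_assoc,
    Matrix.nonsing_inv_mul _ hdet, Matrix.mul_one, ← h2]
  abel
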